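/- arXiv:2111.15076 — 2 statements merged into one kernel-verified Lean document; each statement's English description precedes it below -/
import Mathlib

section
/- The function x ↦ (29x⁴ − 16i·x³ + 50x² − 42i·x − 17)/((x − i)⁵·(x + i)⁵), viewed as a map from ℝ to ℂ, is integrable on ℝ, and its integral over ℝ equals −129π/64. (This is the normal-direction integral arising from the h'(0)-part of the trace expression (3.62) in case (b), yielding the coefficient −129/16·π·h'(0) in (3.69).) -/
open Complex MeasureTheory

lemma integrable_inv_one_add_sq_pow (k : ℕ) :
    Integrable fun x : ℝ => ((1 + x ^ 2)⁻¹) ^ (k + 1) := by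
  refine integrable_inv_one_add_sq.mono' (by fun_prop) (.of_forall fun x => ?_)
  rw [Real.norm_of_nonneg (by positivity)]
  exact pow_le_of_le_one (by positivity) (inv_le_one_of_one_le₀ (by nlinarith)) k.succ_ne_zero

lemma integrable_mul_inv_one_add_sq_pow (k : ℕ) :
    Integrable fun x : ℝ => x * ((1 + x ^ 2)⁻¹) ^ (k + 2) := by
  refine (integrable_inv_one_add_sq_pow k).mono' (by fun_prop) (.of_forall fun x => ?_)
  have hu : 0 < 1 + x ^ 2 := by positivity
  have hx : |x| * (1 + x ^ 2)⁻¹ ≤ 1 := by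
    rw [← div_eq_mul_inv, div_le_one hu]
    nlinarith [sq_abs x, sq_nonneg (|x| - 1)]
  rw [norm_mul, Real.norm_of_nonneg (r := _ ^ _) (by positivity), Real.norm_eq_abs]
  calc |x| * ((1 + x ^ 2)⁻¹) ^ (k + 2)
      = |x| * (1 + x ^ 2)⁻¹ * ((1 + x ^ 2)⁻¹) ^ (k + 1) := by ring
    _ ≤ ((1 + x ^ 2)⁻¹) ^ (k + 1) := mul_le_of_le_one_left (by positivity) hx

lemma integral_mul_inv_one_add_sq_pow (k : ℕ) :
    ∫ x : ℝ, x * ((1 + x ^ 2)⁻¹) ^ k = 0 := by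
  have h := integral_neg_eq_self (fun x : ℝ => x * ((1 + x ^ 2)⁻¹) ^ k) volume
  simp only [neg_sq, neg_mul, integral_neg] at h
  linarith

lemma hasDerivAt_mul_inv_one_add_sq_pow (k : ℕ) (x : ℝ) :
    HasDerivAt (fun x : ℝ => x * ((1 + x ^ 2)⁻¹) ^ (k + 1))
      ((2 * k + 2) * ((1 + x ^ 2)⁻¹) ^ (k + 2) - (2 * k + 1) * ((1 + x ^ 2)⁻¹) ^ (k + 1)) x := by
  have hu : 1 + x ^ 2 ≠ 0 := by positivity
  have h := (hasDerivAt_id x).mul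
    (((((hasDerivAt_id x).pow 2).const_add 1).inv hu).pow (k + 1))
  refine h.congr_deriv ?_
  simp only [id, Pi.pow_apply, Pi.inv_apply]
  push_cast
  simp only [inv_pow]
  field_simp
  ring

lemma integral_inv_one_add_sq_pow_succ (k : ℕ) :
    ∫ x : ℝ, ((1 + x ^ 2)⁻¹) ^ (k + 2) =
      ((2 * k + 1) / (2 * k + 2) : ℝ) * ∫ x : ℝ, ((1 + x ^ 2)⁻¹) ^ (k + 1) := by
  have hi₂ := (integrable_inv_one_add_sq_pow (k + 1)).const_mul (2 * k + 2 : ℝ)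
  have hi₁ := (integrable_inv_one_add_sq_pow k).const_mul (2 * k + 1 : ℝ)
  have hbound (x : ℝ) : ‖x * ((1 + x ^ 2)⁻¹) ^ (k + 1)‖ ≤ |x|⁻¹ := by
    rcases eq_or_ne x 0 with rfl | hx
    · simp
    have hx' : 0 < |x| := abs_pos.mpr hx
    have hu : (1 + x ^ 2)⁻¹ ≤ 1 := inv_le_one_of_one_le₀ (by nlinarith)
    rw [Real.norm_eq_abs, abs_mul, abs_of_nonneg (a := _ ^ _) (by positivity)]
    calc |x| * ((1 + x ^ 2)⁻¹) ^ (k + 1)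
        ≤ |x| * (1 + x ^ 2)⁻¹ := by
          gcongr
          exact pow_le_of_le_one (by positivity) hu k.succ_ne_zero
      _ ≤ |x|⁻¹ := by
          rw [← div_eq_mul_inv, div_le_iff₀ (by positivity), ← sq_abs x]
          field_simp
          linarith
  have hbot := squeeze_zero_norm hbound
    (tendsto_inv_atTop_zero.comp Filter.tendsto_abs_atBot_atTop)
  have htop := squeeze_zero_norm hbound
    (tendsto_inv_atTop_zero.comp Filter.tendsto_abs_atTop_atTop)
  have h := integral_of_hasDerivAt_of_tendsto (hasDerivAt_mul_inv_one_add_sq_pow k)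
    (hi₂.sub hi₁) hbot htop
  rw [integral_sub hi₂ hi₁, integral_const_mul, integral_const_mul] at h
  rw [div_mul_eq_mul_div, eq_div_iff (by positivity)]
  linarith

theorem stmt_4 :
    MeasureTheory.Integrable
      (fun x : ℝ => (29 * (x : ℂ)^4 - 16 * I * (x : ℂ)^3 + 50 * (x : ℂ)^2 - 42 * I * (x : ℂ) - 17) / (((x : ℂ) - I) ^ 5 * ((x : ℂ) + I) ^ 5)) ∧
    ∫ x : ℝ, (29 * (x : ℂ)^4 - 16 * I * (x : ℂ)^3 + 50 * (x : ℂ)^2 - 42 * I * (x : ℂ) - 17) / (((x : ℂ) - I) ^ 5 * ((x : ℂ) + I) ^ 5) = -(129 * (Real.pi : ℂ) / 64) := by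
  let g (x : ℝ) : ℝ :=
    29 * ((1 + x ^ 2)⁻¹) ^ 3 - 8 * ((1 + x ^ 2)⁻¹) ^ 4 - 38 * ((1 + x ^ 2)⁻¹) ^ 5
  let h (x : ℝ) : ℝ :=
    16 * (x * ((1 + x ^ 2)⁻¹) ^ 4) + 26 * (x * ((1 + x ^ 2)⁻¹) ^ 5)
  have hf : (fun x : ℝ => (29 * (x : ℂ)^4 - 16 * I * (x : ℂ)^3 + 50 * (x : ℂ)^2
      - 42 * I * (x : ℂ) - 17) / (((x : ℂ) - I) ^ 5 * ((x : ℂ) + I) ^ 5)) =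
      fun x : ℝ => (g x : ℂ) - I * (h x : ℂ) := by
    funext x
    have hu : (1 + (x : ℂ) ^ 2) ≠ 0 := by
      exact_mod_cast (by positivity : (1 + x ^ 2 : ℝ) ≠ 0)
    have hden : ((x : ℂ) - I) ^ 5 * ((x : ℂ) + I) ^ 5 = (1 + (x : ℂ) ^ 2) ^ 5 := by
      rw [← mul_pow]
      congr 1
      linear_combination -I_sq
    rw [hden]
    simp only [g, h]
    push_cast
    field_simp
    ring
  have i₃ := (integrable_inv_one_add_sq_pow 2).const_mul 29
  have i₄ := (integrable_inv_one_add_sq_pow 3).const_mul 8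
  have i₅ := (integrable_inv_one_add_sq_pow 4).const_mul 38
  have j₄ := (integrable_mul_inv_one_add_sq_pow 2).const_mul 16
  have j₅ := (integrable_mul_inv_one_add_sq_pow 3).const_mul 26
  have i₃₄ : Integrable fun x : ℝ => 29 * ((1 + x ^ 2)⁻¹) ^ 3 - 8 * ((1 + x ^ 2)⁻¹) ^ 4 :=
    i₃.sub i₄
  have hg : Integrable g := i₃₄.sub i₅
  have hh : Integrable h := j₄.add j₅
  have hg_int : ∫ x, g x = -(129 * Real.pi / 64) := by
    have e₂ := integral_inv_one_add_sq_pow_succ 0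
    have e₃ := integral_inv_one_add_sq_pow_succ 1
    have e₄ := integral_inv_one_add_sq_pow_succ 2
    have e₅ := integral_inv_one_add_sq_pow_succ 3
    norm_num only [zero_add, pow_one, integral_univ_inv_one_add_sq] at e₂ e₃ e₄ e₅
    simp only [g]
    rw [integral_sub i₃₄ i₅, integral_sub i₃ i₄, integral_const_mul, integral_const_mul,
      integral_const_mul]
    linarith
  have hh_int : ∫ x, h x = 0 := by
    simp only [h]
    rw [integral_add j₄ j₅, integral_const_mul, integral_const_mul,
      integral_mul_inv_one_add_sq_pow, integral_mul_inv_one_add_sq_pow]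
    simp
  have hgc : Integrable fun x => (g x : ℂ) := hg.ofReal
  have hhc : Integrable fun x => I * (h x : ℂ) := hh.ofReal.const_mul I
  rw [hf]
  refine ⟨hgc.sub hhc, ?_⟩
  rw [integral_sub hgc hhc, integral_const_mul, integral_complex_ofReal, integral_complex_ofReal,
    hg_int, hh_int]
  push_cast
  ring
end

section
/- The function x ↦ (3x² + 12i·x + 3)/((x − i)⁴·(x + i)³), viewed as a map from ℝ to ℂ, is integrable on ℝ, and its integral over ℝ equals 15πi/8. (This is the normal-direction integral arising from the trace expression tr[T₁ × ∂_{ξ_n}σ_{−3}] in equations (3.79) and (5.27) of case (c).) -/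
open Complex MeasureTheory

open Filter Topology

lemma ofReal_add_ne_zero_of_im_ne_zero {a : ℂ} (ha : a.im ≠ 0) (x : ℝ) : (x : ℂ) + a ≠ 0 := by
  intro h
  apply ha
  simpa using congrArg Complex.im h

lemma hasDerivAt_inv_ofReal_add {a : ℂ} (ha : a.im ≠ 0) (x : ℝ) :
    HasDerivAt (fun x : ℝ => ((x : ℂ) + a)⁻¹) (-(((x : ℂ) + a)⁻¹) ^ 2) x := by
  have h := ((hasDerivAt_id x).ofReal_comp.add_const a).inv
    (ofReal_add_ne_zero_of_im_ne_zero ha x)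
  refine h.congr_deriv ?_
  simp [div_eq_mul_inv]

lemma tendsto_inv_ofReal_add_cobounded (a : ℂ) :
    Tendsto (fun x : ℝ => ((x : ℂ) + a)⁻¹) (Bornology.cobounded ℝ) (𝓝 0) := by
  refine tendsto_inv₀_cobounded.comp ?_
  rw [← tendsto_norm_atTop_iff_cobounded]
  refine tendsto_atTop_mono (fun x => ?_)
    (tendsto_atTop_add_const_right _ (-‖a‖) (tendsto_norm_cobounded_atTop (E := ℝ)))
  have h := norm_sub_norm_le (x : ℂ) (-a)
  simp only [norm_neg, sub_neg_eq_add, Complex.norm_real] at h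
  linarith

lemma norm_inv_ofReal_add_le_one {a : ℂ} (ha : 1 ≤ |a.im|) (x : ℝ) : ‖((x : ℂ) + a)⁻¹‖ ≤ 1 := by
  rw [norm_inv]
  refine inv_le_one_of_one_le₀ (ha.trans ?_)
  simpa using Complex.abs_im_le_norm ((x : ℂ) + a)

lemma ofReal_sub_I_ne_zero (x : ℝ) : (x : ℂ) - I ≠ 0 := by
  simpa [sub_eq_add_neg] using ofReal_add_ne_zero_of_im_ne_zero (a := -I) (by simp) x

lemma one_add_sq_eq_sub_I_mul_add_I (z : ℂ) : 1 + z ^ 2 = (z - I) * (z + I) := by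
  linear_combination I_sq

/-- An explicit primitive of the integrand, read off from its partial fraction decomposition. -/
lemma hasDerivAt_primitive (x : ℝ) :
    HasDerivAt (fun x : ℝ => I / 2 * (((x : ℂ) + -I)⁻¹) ^ 3 + 3 * I / 4 * ((x : ℂ) + -I)⁻¹
        - 3 / 8 * (((x : ℂ) + I)⁻¹) ^ 2 + 9 * I / 8 * ((x : ℂ) + I)⁻¹
        + 15 * I / 8 * (Real.arctan x : ℂ))
      ((3 * (x : ℂ) ^ 2 + 12 * I * (x : ℂ) + 3) / (((x : ℂ) - I) ^ 4 * ((x : ℂ) + I) ^ 3)) x := by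
  have hv := hasDerivAt_inv_ofReal_add (a := -I) (by simp) x
  have hu := hasDerivAt_inv_ofReal_add (a := I) (by simp) x
  have ht := (Real.hasDerivAt_arctan x).ofReal_comp
  refine (((((hv.pow 3).const_mul (I / 2)).add (hv.const_mul (3 * I / 4))).sub
    ((hu.pow 2).const_mul (3 / 8))).add (hu.const_mul (9 * I / 8))).add
    (ht.const_mul (15 * I / 8)) |>.congr_deriv ?_
  have hv0 := ofReal_sub_I_ne_zero x
  have hu0 : (x : ℂ) + I ≠ 0 := ofReal_add_ne_zero_of_im_ne_zero (by simp) x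
  push_cast
  rw [one_add_sq_eq_sub_I_mul_add_I, ← sub_eq_add_neg]
  field_simp
  ring_nf
  simp only [show I ^ 6 = -1 by rw [show I ^ 6 = (I ^ 2) ^ 3 by ring, I_sq]; ring,
    show I ^ 5 = I by rw [show I ^ 5 = (I ^ 2) ^ 2 * I by ring, I_sq]; ring,
    I_pow_four, I_pow_three, I_sq]
  ring

lemma integrable_integrand :
    Integrable (fun x : ℝ =>
      (3 * (x : ℂ) ^ 2 + 12 * I * (x : ℂ) + 3) / (((x : ℂ) - I) ^ 4 * ((x : ℂ) + I) ^ 3)) := by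
  have hcont : ∀ {a : ℂ}, a.im ≠ 0 → Continuous fun x : ℝ => ((x : ℂ) + a)⁻¹ := fun ha =>
    continuous_iff_continuousAt.2 fun x => (hasDerivAt_inv_ofReal_add ha x).continuousAt
  have hv := hcont (a := -I) (by simp)
  have hu := hcont (a := I) (by simp)
  have key := (integrable_inv_one_add_sq.ofReal (𝕜 := ℂ)).bdd_mul (c := 21)
    (f := fun x : ℝ => 3 * (((x : ℂ) + -I)⁻¹ ^ 3 + 2 * I * (((x : ℂ) + -I)⁻¹ ^ 3 * ((x : ℂ) + I)⁻¹)
      + 4 * (((x : ℂ) + -I)⁻¹ ^ 3 * ((x : ℂ) + I)⁻¹ ^ 2)))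
    (by fun_prop) (Eventually.of_forall fun x => ?_)
  · refine key.congr (Eventually.of_forall fun x => ?_)
    have hv0 := ofReal_sub_I_ne_zero x
    have hu0 : (x : ℂ) + I ≠ 0 := ofReal_add_ne_zero_of_im_ne_zero (by simp) x
    simp only [coe_algebraMap]
    push_cast
    rw [one_add_sq_eq_sub_I_mul_add_I, ← sub_eq_add_neg]
    field_simp
    linear_combination (9 : ℂ) * I_sq
  · have h1 := norm_inv_ofReal_add_le_one (a := -I) (by simp) x
    have h2 := norm_inv_ofReal_add_le_one (a := I) (by simp) x
    generalize ((x : ℂ) + -I)⁻¹ = v at *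
    generalize ((x : ℂ) + I)⁻¹ = u at *
    have h3 : ‖v‖ ^ 3 ≤ 1 := pow_le_one₀ (norm_nonneg v) h1
    have h4 : ‖v‖ ^ 3 * ‖u‖ ≤ 1 := mul_le_one₀ h3 (norm_nonneg u) h2
    have h5 : ‖v‖ ^ 3 * ‖u‖ ^ 2 ≤ 1 :=
      mul_le_one₀ h3 (by positivity) (pow_le_one₀ (norm_nonneg u) h2)
    have h6 := norm_add₃_le (a := v ^ 3) (b := 2 * I * (v ^ 3 * u)) (c := 4 * (v ^ 3 * u ^ 2))
    rw [norm_mul]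
    simp only [norm_mul, norm_pow, norm_I, RCLike.norm_ofNat] at h6 ⊢
    linarith

theorem stmt_8 :
    MeasureTheory.Integrable
      (fun x : ℝ => (3 * (x : ℂ)^2 + 12 * I * (x : ℂ) + 3) / (((x : ℂ) - I) ^ 4 * ((x : ℂ) + I) ^ 3)) ∧
    ∫ x : ℝ, (3 * (x : ℂ)^2 + 12 * I * (x : ℂ) + 3) / (((x : ℂ) - I) ^ 4 * ((x : ℂ) + I) ^ 3) = 15 * (Real.pi : ℂ) * I / 8 := by
  refine ⟨integrable_integrand, ?_⟩
  have hlim : ∀ {l : Filter ℝ} {t : ℝ}, l ≤ Bornology.cobounded ℝ →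
      Tendsto Real.arctan l (𝓝 t) →
      Tendsto (fun x : ℝ => I / 2 * (((x : ℂ) + -I)⁻¹) ^ 3 + 3 * I / 4 * ((x : ℂ) + -I)⁻¹
        - 3 / 8 * (((x : ℂ) + I)⁻¹) ^ 2 + 9 * I / 8 * ((x : ℂ) + I)⁻¹
        + 15 * I / 8 * (Real.arctan x : ℂ)) l (𝓝 (15 * I / 8 * t)) := by
    intro l t hl ht
    have hv := (tendsto_inv_ofReal_add_cobounded (-I)).mono_left hl
    have hu := (tendsto_inv_ofReal_add_cobounded I).mono_left hl
    have ht' := (continuous_ofReal.tendsto t).comp ht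
    simpa using (((((hv.pow 3).const_mul (I / 2)).add (hv.const_mul (3 * I / 4))).sub
      ((hu.pow 2).const_mul (3 / 8))).add (hu.const_mul (9 * I / 8))).add
      (ht'.const_mul (15 * I / 8))
  rw [integral_of_hasDerivAt_of_tendsto hasDerivAt_primitive integrable_integrand
    (hlim (IsOrderBornology.atBot_le_cobounded)
      (Real.tendsto_arctan_atBot.mono_right nhdsWithin_le_nhds))
    (hlim (IsOrderBornology.atTop_le_cobounded)
      (Real.tendsto_arctan_atTop.mono_right nhdsWithin_le_nhds))]
  push_cast
  ring
end
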